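/- There exist absolute constants c > 0 and C > 0 such that the following holds. Let X be a finite group and S ⊆ X a normal subset (closed under conjugation) with d = |S| ≥ 1, and suppose the Cayley sum graph C_Σ(X,S) is non-bipartite. List the eigenvalues of the normalized adjacency matrix (1/d)A of C_Σ(X,S) with multiplicity as t₁ ≤ t₂ ≤ ⋯ ≤ t_N, where N = |X|. Then for every i ≤ N−1, the eigenvalue t_i lies in the interval [−1 + c·h_out²/d, 1 − C·h_out²/d], where h_out is the outer vertex isoperimetric constant of C_Σ(X,S). -/

import Mathlib

attribute [local instance] Classical.propDecidable

/-- The outer vertex boundary of a finite set `U`: vertices outside `U` with a neighbor in `U`. -/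
noncomputable def outBd {V : Type*} [Fintype V] (Adj : V → V → Prop) (U : Finset V) : Finset V :=
  Finset.univ.filter fun y => y ∉ U ∧ ∃ x ∈ U, Adj x y

/-- The outer vertex isoperimetric constant: the minimum of `|∂_out U|/|U|` over nonempty sets
`U` with `|U| ≤ |V|/2`. -/
noncomputable def hOut {V : Type*} [Fintype V] (Adj : V → V → Prop) : ℝ :=
  sInf {r : ℝ | ∃ U : Finset V, U.Nonempty ∧ 2 * U.card ≤ Fintype.card V ∧
    r = ((outBd Adj U).card : ℝ) / (U.card : ℝ)}

/-- A graph is bipartite if the vertex set can be partitioned into two parts such that every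
edge joins the two parts. -/
def Bipartite {V : Type*} (Adj : V → V → Prop) : Prop :=
  ∃ P : V → Bool, ∀ x y, Adj x y → P x ≠ P y

open Finset in
/-- Finite layer-cake comparison. -/
theorem sum_le_sum_of_card_superlevel {V : Type*} [Fintype V] (a b : V → ℝ)
    (ha : ∀ x, 0 ≤ a x) (hb : ∀ x, 0 ≤ b x) {k : ℝ} (hk : 0 ≤ k)
    (h : ∀ r : ℝ, 0 < r → k * #{x | r < b x} ≤ (#{x | r < a x} : ℝ)) :
    k * ∑ x, b x ≤ ∑ x, a x := by
  let _ : MeasurableSpace V := ⊤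
  have layer : ∀ f : V → ℝ, (∀ x, 0 ≤ f x) → ENNReal.ofReal (∑ x, f x) =
      ∫⁻ r in Set.Ioi (0 : ℝ), ENNReal.ofReal (#{x | r < f x} : ℝ) := by
    intro f hf
    have := MeasureTheory.lintegral_eq_lintegral_meas_lt (MeasureTheory.Measure.count (α := V))
      (Filter.Eventually.of_forall hf) (measurable_from_top.aemeasurable)
    rw [MeasureTheory.lintegral_count, tsum_fintype,
      ← ENNReal.ofReal_sum_of_nonneg (fun x _ => hf x)] at this
    rw [this]
    refine MeasureTheory.lintegral_congr fun r => ?_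
    rw [MeasureTheory.Measure.count_apply MeasurableSpace.measurableSet_top, Set.encard_eq_coe_toFinset_card]
    simp [ENNReal.ofReal_natCast]
  have key : ENNReal.ofReal (k * ∑ x, b x) ≤ ENNReal.ofReal (∑ x, a x) := by
    rw [ENNReal.ofReal_mul hk, layer a ha, layer b hb,
      ← MeasureTheory.lintegral_const_mul' _ _ ENNReal.ofReal_ne_top]
    refine MeasureTheory.setLIntegral_mono' measurableSet_Ioi fun r hr => ?_
    rw [← ENNReal.ofReal_mul hk]
    exact ENNReal.ofReal_le_ofReal (h r hr)
  exact (ENNReal.ofReal_le_ofReal_iff (Finset.sum_nonneg fun x _ => ha x)).1 key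

theorem hOut_nonneg {V : Type*} [Fintype V] (Adj : V → V → Prop) : 0 ≤ hOut Adj := by
  apply Real.sInf_nonneg
  rintro r ⟨U, -, -, rfl⟩
  positivity

theorem hOut_le_div {V : Type*} [Fintype V] (Adj : V → V → Prop) (U : Finset V)
    (hU : U.Nonempty) (hc : 2 * U.card ≤ Fintype.card V) :
    hOut Adj ≤ ((outBd Adj U).card : ℝ) / U.card := by
  refine csInf_le ⟨0, ?_⟩ ⟨U, hU, hc, rfl⟩
  rintro r ⟨U, -, -, rfl⟩
  positivity

theorem hOut_mul_card_le {V : Type*} [Fintype V] (Adj : V → V → Prop) (U : Finset V)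
    (hc : 2 * U.card ≤ Fintype.card V) :
    hOut Adj * U.card ≤ ((outBd Adj U).card : ℝ) := by
  rcases U.eq_empty_or_nonempty with rfl | hU
  · simp
  · exact (le_div_iff₀ (by exact_mod_cast hU.card_pos)).1 (hOut_le_div Adj U hU hc)

theorem hOut_le_two {V : Type*} [Fintype V] (Adj : V → V → Prop)
    (hV : 2 ≤ Fintype.card V) : hOut Adj ≤ 2 := by
  obtain ⟨U, -, hU⟩ := Finset.exists_subset_card_eq
    (s := (Finset.univ : Finset V)) (n := Fintype.card V / 2)
    (by rw [Finset.card_univ]; omega)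
  have hpos : 0 < U.card := by omega
  refine (hOut_le_div Adj U (Finset.card_pos.1 hpos) (by omega)).trans ?_
  rw [div_le_iff₀ (by exact_mod_cast hpos)]
  have hd : Disjoint (outBd Adj U) U := by
    rw [Finset.disjoint_left]
    intro x hx
    exact (Finset.mem_filter.1 hx).2.1
  have := (Finset.card_union_of_disjoint hd).symm.trans_le (Finset.card_le_univ _)
  have : (outBd Adj U).card ≤ 2 * U.card := by omega
  exact_mod_cast this

open Finset in
/-- Vertex Cheeger inequality for a nonnegative function supported on at most half of the
vertices. -/
theorem hOut_sq_mul_sum_sq_le_of_support {V : Type*} [Fintype V] (Adj : V → V → Prop)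
    (hsymm : ∀ x y, Adj x y → Adj y x) (hV : 2 ≤ Fintype.card V) (g : V → ℝ)
    (hg : ∀ x, 0 ≤ g x) (hsupp : 2 * #{x | 0 < g x} ≤ Fintype.card V) :
    hOut Adj ^ 2 / 8 * ∑ x, g x ^ 2 ≤
      ∑ x, ∑ y, if Adj x y then (g x - g y) ^ 2 else 0 := by
  have hmax : ∀ x, ∃ y, (y = x ∨ Adj x y) ∧ ∀ z, (z = x ∨ Adj x z) → g z ≤ g y := by
    intro x
    obtain ⟨y, hy, hy'⟩ := Finset.exists_max_image
      (univ.filter fun y => y = x ∨ Adj x y) g ⟨x, by simp⟩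
    exact ⟨y, by simpa using hy, fun z hz => hy' z (by simpa using hz)⟩
  choose a ha ha' using hmax
  set h := hOut Adj
  have h0 : 0 ≤ h := hOut_nonneg Adj
  have h2 : h ≤ 2 := hOut_le_two Adj hV
  have hlayer : (1 + h) * ∑ x, g x ^ 2 ≤ ∑ x, g (a x) ^ 2 := by
    refine sum_le_sum_of_card_superlevel _ _ (fun x => sq_nonneg _) (fun x => sq_nonneg _)
      (by linarith) fun r hr => ?_
    set U : Finset V := univ.filter fun x => r < g x ^ 2 with hU
    have hUc : 2 * #U ≤ Fintype.card V := by
      refine le_trans ?_ hsupp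
      gcongr
      intro x hx
      simp only [hU, Finset.mem_filter, Finset.mem_univ, true_and] at hx ⊢
      exact (hg x).lt_of_ne fun h1 => by
        rw [← h1] at hx
        norm_num at hx
        linarith
    have hb := hOut_mul_card_le Adj U hUc
    have hd : Disjoint U (outBd Adj U) := by
      rw [Finset.disjoint_right]
      intro x hx
      exact (Finset.mem_filter.1 hx).2.1
    have hsub : U ∪ outBd Adj U ⊆ univ.filter fun x => r < g (a x) ^ 2 := by
      intro x hx
      have hle : ∀ z, (z = x ∨ Adj x z) → r < g z ^ 2 → r < g (a x) ^ 2 := fun z hz hr =>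
        hr.trans_le (pow_le_pow_left₀ (hg z) (ha' x z hz) 2)
      simp only [Finset.mem_union, outBd, Finset.mem_filter, Finset.mem_univ, true_and, hU] at hx ⊢
      rcases hx with hx | ⟨-, z, hz, hzx⟩
      · exact hle x (Or.inl rfl) hx
      · exact hle z (Or.inr (hsymm _ _ hzx)) hz
    have hcard : (#U : ℝ) + #(outBd Adj U) ≤ #(univ.filter fun x => r < g (a x) ^ 2) := by
      exact_mod_cast (Finset.card_union_of_disjoint hd).symm.trans_le (Finset.card_le_card hsub)
    linarith
  have hD : ∑ x, (g (a x) - g x) ^ 2 ≤ ∑ x, ∑ y, if Adj x y then (g x - g y) ^ 2 else 0 := by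
    refine Finset.sum_le_sum fun x _ => ?_
    have hnn : ∀ y ∈ univ, 0 ≤ if Adj x y then (g x - g y) ^ 2 else 0 := fun y _ => by
      split_ifs <;> positivity
    rcases ha x with h1 | h1
    · rw [h1, sub_self]
      simpa using Finset.sum_nonneg hnn
    · have := Finset.single_le_sum hnn (Finset.mem_univ (a x))
      rw [if_pos h1] at this
      linarith [sq_nonneg (g (a x) - g x), this,
        show (g x - g (a x)) ^ 2 = (g (a x) - g x) ^ 2 by ring]
  have hpt : ∑ x, h * g (a x) ^ 2 ≤
      ∑ x, (h * g x ^ 2 + h ^ 2 / 2 * g x ^ 2 + 4 * (g (a x) - g x) ^ 2) := by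
    refine Finset.sum_le_sum fun x _ => ?_
    nlinarith [sq_nonneg (h * g x - 2 * (g (a x) - g x)),
      mul_nonneg (sub_nonneg.2 h2) (sq_nonneg (g (a x) - g x))]
  simp only [Finset.sum_add_distrib, ← Finset.mul_sum] at hpt
  have := mul_le_mul_of_nonneg_left hlayer h0
  nlinarith

open Finset in
theorem exists_median {V : Type*} [Fintype V] [Nonempty V] (g : V → ℝ) :
    ∃ m, 2 * #{x | m < g x} ≤ Fintype.card V ∧ 2 * #{x | g x < m} ≤ Fintype.card V := by
  obtain ⟨x₀, -, hx₀⟩ := Finset.exists_max_image univ g univ_nonempty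
  obtain ⟨x₁, hx₁, hmin⟩ := Finset.exists_min_image
    (univ.filter fun x => 2 * #{y | g x < g y} ≤ Fintype.card V) g ⟨x₀, by
      have : (univ.filter fun y => g x₀ < g y) = ∅ := by
        ext y
        simpa using hx₀ y (Finset.mem_univ y)
      simp [this]⟩
  refine ⟨g x₁, by simpa using hx₁, ?_⟩
  by_contra! hlt
  have hne : (univ.filter fun x => g x < g x₁).Nonempty := by
    rw [← Finset.card_pos]
    omega
  obtain ⟨x₂, hx₂, hmax⟩ := Finset.exists_max_image _ g hne
  have hx₂' : g x₂ < g x₁ := by simpa using hx₂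
  refine absurd (hmin x₂ ?_) (not_le.2 hx₂')
  have hd : Disjoint (univ.filter fun x => g x < g x₁) (univ.filter fun x => g x₂ < g x) := by
    rw [Finset.disjoint_left]
    intro x hx hx'
    exact absurd (hmax x hx) (not_le.2 (by simpa using hx'))
  have := (Finset.card_union_of_disjoint hd).symm.trans_le (Finset.card_le_univ _)
  simp only [Finset.mem_filter, Finset.mem_univ, true_and]
  omega

/-- Vertex Cheeger inequality in Poincaré form. -/
theorem exists_hOut_sq_mul_sum_sq_le {V : Type*} [Fintype V] (Adj : V → V → Prop)
    (hsymm : ∀ x y, Adj x y → Adj y x) (hV : 2 ≤ Fintype.card V) (g : V → ℝ) :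
    ∃ m, hOut Adj ^ 2 / 8 * ∑ x, (g x - m) ^ 2 ≤
      ∑ x, ∑ y, if Adj x y then (g x - g y) ^ 2 else 0 := by
  have : Nonempty V := Fintype.card_pos_iff.1 (by omega)
  obtain ⟨m, hm₁, hm₂⟩ := exists_median g
  have hp := hOut_sq_mul_sum_sq_le_of_support Adj hsymm hV (fun x => max (g x - m) 0)
    (fun x => le_max_right _ _) (by simpa using hm₁)
  have hq := hOut_sq_mul_sum_sq_le_of_support Adj hsymm hV (fun x => max (m - g x) 0)
    (fun x => le_max_right _ _) (by simpa using hm₂)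
  refine ⟨m, ?_⟩
  have hsum : ∑ x, (g x - m) ^ 2 = ∑ x, max (g x - m) 0 ^ 2 + ∑ x, max (m - g x) 0 ^ 2 := by
    rw [← Finset.sum_add_distrib]
    refine Finset.sum_congr rfl fun x _ => ?_
    rcases le_total (g x) m with h | h
    · rw [max_eq_right (by linarith), max_eq_left (by linarith)]; ring
    · rw [max_eq_left (by linarith), max_eq_right (by linarith)]; ring
  rw [hsum, mul_add]
  refine (add_le_add hp hq).trans ?_
  rw [← Finset.sum_add_distrib]
  refine Finset.sum_le_sum fun x _ => ?_
  rw [← Finset.sum_add_distrib]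
  refine Finset.sum_le_sum fun y _ => ?_
  split_ifs
  · rcases le_total (g x) m with h | h <;> rcases le_total (g y) m with h' | h' <;>
      simp only [max_eq_right, max_eq_left, sub_nonneg, sub_nonpos, h, h'] <;> nlinarith
  · simp

/-- Vertex Cheeger inequality for the deviation from the mean. -/
theorem hOut_sq_mul_variance_le {V : Type*} [Fintype V] (Adj : V → V → Prop)
    (hsymm : ∀ x y, Adj x y → Adj y x) (hV : 2 ≤ Fintype.card V) (g : V → ℝ) :
    hOut Adj ^ 2 / 8 * (∑ x, g x ^ 2 - (∑ x, g x) ^ 2 / Fintype.card V) ≤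
      ∑ x, ∑ y, if Adj x y then (g x - g y) ^ 2 else 0 := by
  obtain ⟨m, hm⟩ := exists_hOut_sq_mul_sum_sq_le Adj hsymm hV g
  refine le_trans ?_ hm
  have hN : (0 : ℝ) < Fintype.card V := by exact_mod_cast (by omega : 0 < Fintype.card V)
  gcongr
  have : ∑ x, (g x - m) ^ 2 = ∑ x, g x ^ 2 - 2 * m * ∑ x, g x + Fintype.card V * m ^ 2 := by
    simp only [sub_sq, Finset.sum_add_distrib, Finset.sum_sub_distrib, Finset.mul_sum]
    simp only [Finset.sum_const, Finset.card_univ, nsmul_eq_mul]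
    congr 2
    exact Finset.sum_congr rfl fun x _ => by ring
  have hsq : 0 ≤ ((∑ x, g x) - Fintype.card V * m) ^ 2 / Fintype.card V := by positivity
  have hexp : ((∑ x, g x) - Fintype.card V * m) ^ 2 / Fintype.card V =
      (∑ x, g x) ^ 2 / Fintype.card V - 2 * m * ∑ x, g x + Fintype.card V * m ^ 2 := by
    generalize (∑ x, g x) = T
    field_simp
    ring
  linarith

/-- The Dirichlet forms of an eigenfunction of a regular graph. -/
theorem sum_adj_add_mul_sq {V : Type*} [Fintype V] (Adj : V → V → Prop)
    (hsymm : ∀ x y, Adj x y → Adj y x) {d μ : ℝ}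
    (hreg : ∀ x, ∑ y, (if Adj x y then (1 : ℝ) else 0) = d) (f : V → ℝ)
    (hf : ∀ x, ∑ y, (if Adj x y then f y else 0) = μ * f x) (ε : ℝ) :
    ∑ x, ∑ y, (if Adj x y then (f x + ε * f y) ^ 2 else 0) =
      ((1 + ε ^ 2) * d + 2 * ε * μ) * ∑ x, f x ^ 2 := by
  have h1 : ∑ x, ∑ y, (if Adj x y then f x ^ 2 else 0) = d * ∑ x, f x ^ 2 := by
    rw [Finset.mul_sum]
    refine Finset.sum_congr rfl fun x _ => ?_
    rw [← hreg x, Finset.sum_mul]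
    exact Finset.sum_congr rfl fun y _ => by split_ifs <;> ring
  have h2 : ∑ x, ∑ y, (if Adj x y then f y ^ 2 else 0) = d * ∑ x, f x ^ 2 := by
    rw [Finset.sum_comm, ← h1]
    refine Finset.sum_congr rfl fun x _ => Finset.sum_congr rfl fun y _ => ?_
    exact if_congr ⟨hsymm _ _, hsymm _ _⟩ rfl rfl
  have h3 : ∑ x, ∑ y, (if Adj x y then f x * f y else 0) = μ * ∑ x, f x ^ 2 := by
    rw [Finset.mul_sum]
    refine Finset.sum_congr rfl fun x _ => ?_
    rw [show μ * f x ^ 2 = f x * (μ * f x) by ring, ← hf x, Finset.mul_sum]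
    exact Finset.sum_congr rfl fun y _ => by split_ifs <;> ring
  have : ∑ x, ∑ y, (if Adj x y then (f x + ε * f y) ^ 2 else 0) =
      ∑ x, ∑ y, (if Adj x y then f x ^ 2 else 0) +
      2 * ε * ∑ x, ∑ y, (if Adj x y then f x * f y else 0) +
      ε ^ 2 * ∑ x, ∑ y, (if Adj x y then f y ^ 2 else 0) := by
    simp only [Finset.mul_sum, ← Finset.sum_add_distrib]
    refine Finset.sum_congr rfl fun x _ => Finset.sum_congr rfl fun y _ => ?_
    split_ifs <;> ring
  rw [this, h1, h2, h3]
  ring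

/-- Eigenvalues of a `d`-regular graph are at most `d` in absolute value. -/
theorem eigenvalue_mem_Icc {V : Type*} [Fintype V] (Adj : V → V → Prop)
    (hsymm : ∀ x y, Adj x y → Adj y x) {d μ : ℝ}
    (hreg : ∀ x, ∑ y, (if Adj x y then (1 : ℝ) else 0) = d) (f : V → ℝ)
    (hf : ∀ x, ∑ y, (if Adj x y then f y else 0) = μ * f x)
    (hpos : 0 < ∑ x, f x ^ 2) : -d ≤ μ ∧ μ ≤ d := by
  have key : ∀ ε : ℝ, 0 ≤ (1 + ε ^ 2) * d + 2 * ε * μ := by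
    intro ε
    have := sum_adj_add_mul_sq Adj hsymm hreg f hf ε
    refine nonneg_of_mul_nonneg_left (this ▸ ?_) hpos
    exact Finset.sum_nonneg fun x _ => Finset.sum_nonneg fun y _ => by
      split_ifs <;> positivity
  constructor
  · linarith [key 1]
  · linarith [key (-1)]

/-- Eigenfunctions for eigenvalues other than the degree have mean zero. -/
theorem sum_eq_zero_of_eigenvalue_ne {V : Type*} [Fintype V] (Adj : V → V → Prop)
    (hsymm : ∀ x y, Adj x y → Adj y x) {d μ : ℝ}
    (hreg : ∀ x, ∑ y, (if Adj x y then (1 : ℝ) else 0) = d) (f : V → ℝ)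
    (hf : ∀ x, ∑ y, (if Adj x y then f y else 0) = μ * f x) (hne : μ ≠ d) :
    ∑ x, f x = 0 := by
  have h1 : ∑ x, ∑ y, (if Adj x y then f y else 0) = μ * ∑ x, f x := by
    rw [Finset.mul_sum]
    exact Finset.sum_congr rfl fun x _ => hf x
  have h2 : ∑ x, ∑ y, (if Adj x y then f y else 0) = d * ∑ x, f x := by
    rw [Finset.sum_comm, Finset.mul_sum]
    refine Finset.sum_congr rfl fun y _ => ?_
    rw [← hreg y, Finset.sum_mul]
    refine Finset.sum_congr rfl fun x _ => ?_
    rw [ite_mul, one_mul, zero_mul]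
    exact if_congr ⟨hsymm _ _, hsymm _ _⟩ rfl rfl
  have h3 : (μ - d) * ∑ x, f x = 0 := by linarith
  exact (mul_eq_zero.1 h3).resolve_left (sub_ne_zero.2 hne)

/-- Spectral gap at the top for eigenvalues other than the degree. -/
theorem hOut_sq_mul_le_of_eigenvalue_ne {V : Type*} [Fintype V] (Adj : V → V → Prop)
    (hsymm : ∀ x y, Adj x y → Adj y x) (hV : 2 ≤ Fintype.card V) {d μ : ℝ}
    (hreg : ∀ x, ∑ y, (if Adj x y then (1 : ℝ) else 0) = d) (f : V → ℝ)
    (hf : ∀ x, ∑ y, (if Adj x y then f y else 0) = μ * f x) (hne : μ ≠ d)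
    (hpos : 0 < ∑ x, f x ^ 2) : hOut Adj ^ 2 / 16 ≤ d - μ := by
  have h1 := hOut_sq_mul_variance_le Adj hsymm hV f
  rw [sum_eq_zero_of_eigenvalue_ne Adj hsymm hreg f hf hne] at h1
  have h2 := sum_adj_add_mul_sq Adj hsymm hreg f hf (-1)
  simp only [neg_one_mul, ← sub_eq_add_neg] at h2
  rw [h2] at h1
  have := le_of_mul_le_mul_right (by simpa using h1) hpos
  linarith

/-- With positive vertex expansion, eigenfunctions for the degree are constant. -/
theorem eq_of_eigenvalue_eq {V : Type*} [Fintype V] (Adj : V → V → Prop)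
    (hsymm : ∀ x y, Adj x y → Adj y x) (hV : 2 ≤ Fintype.card V) (hpos : 0 < hOut Adj) {d : ℝ}
    (hreg : ∀ x, ∑ y, (if Adj x y then (1 : ℝ) else 0) = d) (f : V → ℝ)
    (hf : ∀ x, ∑ y, (if Adj x y then f y else 0) = d * f x) : ∃ m, ∀ x, f x = m := by
  obtain ⟨m, hm⟩ := exists_hOut_sq_mul_sum_sq_le Adj hsymm hV f
  have h2 := sum_adj_add_mul_sq Adj hsymm hreg f hf (-1)
  simp only [neg_one_mul, ← sub_eq_add_neg] at h2
  rw [h2] at hm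
  have h3 : ∑ x, (f x - m) ^ 2 ≤ 0 := by
    have : hOut Adj ^ 2 / 8 * ∑ x, (f x - m) ^ 2 ≤ hOut Adj ^ 2 / 8 * 0 := by linarith
    exact le_of_mul_le_mul_left this (by positivity)
  refine ⟨m, fun x => ?_⟩
  have h4 := (Finset.single_le_sum (f := fun x => (f x - m) ^ 2)
    (fun x _ => sq_nonneg _) (Finset.mem_univ x)).trans h3
  have := pow_eq_zero_iff (two_ne_zero) |>.1 (le_antisymm h4 (sq_nonneg _))
  linarith

/-- If an eigenvalue is close to minus the degree, then its eigenfunctions have almost constant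
absolute value. -/
theorem sum_abs_sub_sq_le {V : Type*} [Fintype V] (Adj : V → V → Prop)
    (hsymm : ∀ x y, Adj x y → Adj y x) (hV : 2 ≤ Fintype.card V) (hh : 0 < hOut Adj) {d μ c : ℝ}
    (hreg : ∀ x, ∑ y, (if Adj x y then (1 : ℝ) else 0) = d) (f : V → ℝ)
    (hf : ∀ x, ∑ y, (if Adj x y then f y else 0) = μ * f x)
    (hμ : d + μ ≤ c * hOut Adj ^ 2) {σ : ℝ} (hσ : 0 ≤ σ)
    (hfσ : ∑ x, f x ^ 2 = Fintype.card V * σ ^ 2) :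
    ∑ x, (|f x| - σ) ^ 2 ≤ 32 * c * (Fintype.card V * σ ^ 2) := by
  have hN : (0 : ℝ) < Fintype.card V := by exact_mod_cast (by omega : 0 < Fintype.card V)
  have h1 := hOut_sq_mul_variance_le Adj hsymm hV (fun x => |f x|)
  have h2 := sum_adj_add_mul_sq Adj hsymm hreg f hf 1
  have h3 : ∑ x, ∑ y, (if Adj x y then (|f x| - |f y|) ^ 2 else 0) ≤
      ∑ x, ∑ y, (if Adj x y then (f x + 1 * f y) ^ 2 else 0) := by
    refine Finset.sum_le_sum fun x _ => Finset.sum_le_sum fun y _ => ?_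
    split_ifs
    · have := neg_abs_le (f x * f y)
      rw [abs_mul] at this
      nlinarith [sq_abs (f x), sq_abs (f y)]
    · rfl
  simp only [sq_abs] at h1
  rw [h2] at h3
  set T := ∑ x, |f x| with hT
  have hT0 : 0 ≤ T := Finset.sum_nonneg fun x _ => abs_nonneg _
  rw [hfσ] at h1 h3
  set N : ℝ := (Fintype.card V : ℝ)
  have hvar : N * σ ^ 2 - T ^ 2 / N ≤ 16 * c * (N * σ ^ 2) := by
    have h4 : hOut Adj ^ 2 / 8 * (N * σ ^ 2 - T ^ 2 / N) ≤
        hOut Adj ^ 2 / 8 * (16 * c * (N * σ ^ 2)) := by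
      refine (h1.trans h3).trans ?_
      have : 0 ≤ N * σ ^ 2 := by positivity
      nlinarith
    exact le_of_mul_le_mul_left h4 (by positivity)
  have hexp : ∑ x, (|f x| - σ) ^ 2 = 2 * (N * σ ^ 2) - 2 * σ * T := by
    simp only [sub_sq, sq_abs, Finset.sum_add_distrib, Finset.sum_sub_distrib]
    rw [hfσ, Finset.sum_const, Finset.card_univ, nsmul_eq_mul, hT, Finset.mul_sum]
    rw [Finset.sum_congr rfl (fun x _ => (by ring : 2 * |f x| * σ = 2 * σ * |f x|))]
    ring
  have hCS : T ^ 2 ≤ N * (N * σ ^ 2) := by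
    have := sq_sum_le_card_mul_sum_sq (s := (Finset.univ : Finset V)) (f := fun x => |f x|)
    simpa only [sq_abs, hfσ, Finset.card_univ] using this
  have hTle : T ≤ N * σ := (abs_le_of_sq_le_sq' (hCS.trans_eq (by ring)) (by positivity)).2
  have h5 : T ^ 2 / N ≤ σ * T := by
    rw [div_le_iff₀ hN]
    nlinarith
  rw [hexp]
  linarith

/-- Eigenspaces for eigenvalues close to minus the degree are at most one-dimensional:
no two normalized eigenfunctions are orthogonal. -/
theorem false_of_orthogonal_eigenfunctions {V : Type*} [Fintype V] (Adj : V → V → Prop)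
    (hsymm : ∀ x y, Adj x y → Adj y x) (hV : 2 ≤ Fintype.card V) (hh : 0 < hOut Adj) {d μ : ℝ}
    (hreg : ∀ x, ∑ y, (if Adj x y then (1 : ℝ) else 0) = d)
    (hμ : d + μ ≤ 1 / 1000 * hOut Adj ^ 2) (f g : V → ℝ)
    (hf : ∀ x, ∑ y, (if Adj x y then f y else 0) = μ * f x)
    (hg : ∀ x, ∑ y, (if Adj x y then g y else 0) = μ * g x)
    (hfg : ∑ x, f x * g x = 0) (hfpos : ∑ x, f x ^ 2 = Fintype.card V)
    (hgpos : ∑ x, g x ^ 2 = Fintype.card V) : False := by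
  have hN : (0 : ℝ) < Fintype.card V := by exact_mod_cast (by omega : 0 < Fintype.card V)
  have hs2 : √(2 : ℝ) ^ 2 = 2 := Real.sq_sqrt (by norm_num)
  have b1 := sum_abs_sub_sq_le Adj hsymm hV hh hreg f hf hμ (σ := 1) (by norm_num)
    (by simpa using hfpos)
  have b2 := sum_abs_sub_sq_le Adj hsymm hV hh hreg g hg hμ (σ := 1) (by norm_num)
    (by simpa using hgpos)
  have b3 := sum_abs_sub_sq_le Adj hsymm hV hh hreg (fun x => f x + g x) (fun x => by
    rw [mul_add, ← hf, ← hg, ← Finset.sum_add_distrib]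
    exact Finset.sum_congr rfl fun y _ => by split_ifs <;> simp) hμ (σ := √2) (by positivity) (by
      simp only [add_sq, Finset.sum_add_distrib, mul_assoc, ← Finset.mul_sum]
      rw [hfg, hfpos, hgpos, hs2]
      ring)
  have b4 := sum_abs_sub_sq_le Adj hsymm hV hh hreg (fun x => f x - g x) (fun x => by
    rw [mul_sub, ← hf, ← hg, ← Finset.sum_sub_distrib]
    exact Finset.sum_congr rfl fun y _ => by split_ifs <;> simp) hμ (σ := √2) (by positivity) (by
      simp only [sub_sq, Finset.sum_add_distrib, Finset.sum_sub_distrib, mul_assoc,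
        ← Finset.mul_sum]
      rw [hfg, hfpos, hgpos, hs2]
      ring)
  rw [hs2] at b3 b4
  have hpt : ∑ _x : V, (2 / 3 : ℝ) ≤ ∑ x, ((|f x| - 1) ^ 2 + (|g x| - 1) ^ 2 +
      (|f x + g x| - √2) ^ 2 + (|f x - g x| - √2) ^ 2) := by
    refine Finset.sum_le_sum fun x _ => ?_
    have hmin : |f x + g x| = |(|f x| - |g x|)| ∨ |f x - g x| = |(|f x| - |g x|)| := by
      rcases abs_cases (f x) with h | h <;> rcases abs_cases (g x) with h' | h' <;>
        rw [h.1, h'.1]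
      · right; rfl
      · left; congr 1; ring
      · left; rw [← abs_neg]; congr 1; ring
      · right; rw [← abs_neg]; congr 1; ring
    have hq : ∀ e : ℝ, e ^ 2 = (|f x| - |g x|) ^ 2 →
        2 / 3 ≤ (|f x| - 1) ^ 2 + (|g x| - 1) ^ 2 + (e - √2) ^ 2 := by
      intro e he
      nlinarith [sq_nonneg (|f x| - 1 + (|g x| - 1)), sq_nonneg (3 * e - 2 * √2)]
    rcases hmin with h | h
    · have := hq |f x + g x| (by rw [h, sq_abs])
      nlinarith [sq_nonneg (|f x - g x| - √2)]
    · have := hq |f x - g x| (by rw [h, sq_abs])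
      nlinarith [sq_nonneg (|f x + g x| - √2)]
  simp only [Finset.sum_add_distrib, Finset.sum_const, Finset.card_univ, nsmul_eq_mul] at hpt
  nlinarith

section CayleySum

variable {X : Type*} [Group X]

theorem cayleySum_symm {S : Finset X} {Adj : X → X → Prop} (hS : ∀ x : X, ∀ s ∈ S, x * s * x⁻¹ ∈ S)
    (hAdj : ∀ x y, Adj x y ↔ x * y ∈ S) (x y : X) (h : Adj x y) : Adj y x := by
  rw [hAdj] at h ⊢
  simpa [mul_assoc] using hS y _ h

variable [Fintype X] {S : Finset X} {Adj : X → X → Prop}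

theorem cayleySum_sum_adj (hAdj : ∀ x y, Adj x y ↔ x * y ∈ S) (f : X → ℝ) (x : X) :
    ∑ y, (if Adj x y then f y else 0) = ∑ s ∈ S, f (x⁻¹ * s) := by
  rw [← Finset.sum_filter]
  refine Finset.sum_bij' (fun y _ => x * y) (fun s _ => x⁻¹ * s) ?_ ?_ ?_ ?_ ?_ <;>
    simp [hAdj]

/-- Left translates of an eigenfunction are intertwined with right translates. -/
theorem cayleySum_sum_adj_mul_left (hAdj : ∀ x y, Adj x y ↔ x * y ∈ S) {μ : ℝ} (f : X → ℝ)
    (hf : ∀ x, ∑ y, (if Adj x y then f y else 0) = μ * f x) (g x : X) :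
    ∑ y, (if Adj x y then f (g * y) else 0) = μ * f (x * g⁻¹) := by
  rw [← hf]
  refine Fintype.sum_equiv (Equiv.mulLeft g) _ _ fun y => ?_
  refine if_congr ?_ rfl rfl
  simp [hAdj, mul_assoc]

theorem cayleySum_sum_adj_mul_right (hS : ∀ x : X, ∀ s ∈ S, x * s * x⁻¹ ∈ S)
    (hAdj : ∀ x y, Adj x y ↔ x * y ∈ S) {μ : ℝ} (f : X → ℝ)
    (hf : ∀ x, ∑ y, (if Adj x y then f y else 0) = μ * f x) (g x : X) :
    ∑ y, (if Adj x y then f (y * g⁻¹) else 0) = μ * f (g * x) := by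
  rw [← hf]
  refine Fintype.sum_equiv (Equiv.mulRight g⁻¹) _ _ fun y => ?_
  refine if_congr ?_ rfl rfl
  simp only [hAdj, Equiv.coe_mulRight]
  constructor <;> intro h
  · simpa [mul_assoc] using hS g _ h
  · simpa [mul_assoc] using hS g⁻¹ _ h

/-- In an expanding Cayley sum graph, an eigenfunction for an eigenvalue close to minus the degree
is scaled by every left translation. -/
theorem exists_mul_left_eq_mul (hS : ∀ x : X, ∀ s ∈ S, x * s * x⁻¹ ∈ S)
    (hAdj : ∀ x y, Adj x y ↔ x * y ∈ S) (hX : 2 ≤ Fintype.card X) (hh : 0 < hOut Adj)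
    {d μ : ℝ} (hreg : ∀ x, ∑ y, (if Adj x y then (1 : ℝ) else 0) = d)
    (hμ : d + μ ≤ 1 / 1000 * hOut Adj ^ 2) (f : X → ℝ)
    (hf : ∀ x, ∑ y, (if Adj x y then f y else 0) = μ * f x) (hpos : 0 < ∑ x, f x ^ 2) (g : X) :
    ∃ a : ℝ, ∀ x, f (g * x) = a * f x := by
  have hsymm := cayleySum_symm hS hAdj
  have hh2 : 0 < hOut Adj ^ 2 := by positivity
  have hLR : ∀ x, f (g * x) = f (x * g⁻¹) := by
    have hw : ∀ x, ∑ y, (if Adj x y then f (g * y) - f (y * g⁻¹) else 0) =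
        -μ * (f (g * x) - f (x * g⁻¹)) := by
      intro x
      rw [show -μ * (f (g * x) - f (x * g⁻¹)) = μ * f (x * g⁻¹) - μ * f (g * x) by ring,
        ← cayleySum_sum_adj_mul_left hAdj f hf, ← cayleySum_sum_adj_mul_right hS hAdj f hf,
        ← Finset.sum_sub_distrib]
      exact Finset.sum_congr rfl fun y _ => by split_ifs <;> simp
    by_cases hd : -μ = d
    · rw [hd] at hw
      obtain ⟨m, hm⟩ := eq_of_eigenvalue_eq Adj hsymm hX hh hreg _ hw
      have hsum : ∑ x, (f (g * x) - f (x * g⁻¹)) = 0 := by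
        rw [Finset.sum_sub_distrib, sub_eq_zero]
        exact (Equiv.sum_comp (Equiv.mulLeft g) f).trans
          (Equiv.sum_comp (Equiv.mulRight g⁻¹) f).symm
      simp only [hm, Finset.sum_const, Finset.card_univ, nsmul_eq_mul] at hsum
      have hm0 : m = 0 := (mul_eq_zero.1 hsum).resolve_left
        (by exact_mod_cast (by omega : Fintype.card X ≠ 0))
      intro x
      linarith [hm x]
    · by_contra! hne
      obtain ⟨x, hx⟩ := hne
      have := hOut_sq_mul_le_of_eigenvalue_ne Adj hsymm hX hreg _ hw hd
        (Finset.sum_pos' (fun y _ => sq_nonneg _)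
          ⟨x, Finset.mem_univ x, by have := sub_ne_zero.2 hx; positivity⟩)
      linarith
  have hL : ∀ x, ∑ y, (if Adj x y then f (g * y) else 0) = μ * f (g * x) := fun x => by
    rw [cayleySum_sum_adj_mul_left hAdj f hf, hLR]
  set B := ∑ x, f x ^ 2 with hB
  set a := (∑ x, f (g * x) * f x) / B with ha
  refine ⟨a, ?_⟩
  by_contra! hne
  obtain ⟨x, hx⟩ := hne
  set w : X → ℝ := fun x => f (g * x) - a * f x with hwdef
  have hwf : ∀ x, ∑ y, (if Adj x y then w y else 0) = μ * w x := by
    intro x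
    simp only [hwdef]
    rw [mul_sub, ← hL, show μ * (a * f x) = a * (μ * f x) by ring, ← hf, Finset.mul_sum,
      ← Finset.sum_sub_distrib]
    exact Finset.sum_congr rfl fun y _ => by split_ifs <;> simp
  have horth : ∑ x, f x * w x = 0 := by
    have : ∑ x, f x * w x = ∑ x, f (g * x) * f x - a * B := by
      rw [hB, Finset.mul_sum, ← Finset.sum_sub_distrib]
      exact Finset.sum_congr rfl fun y _ => by simp only [hwdef]; ring
    rw [this, ha, div_mul_cancel₀ _ hpos.ne', sub_self]
  have hW : 0 < ∑ x, w x ^ 2 := Finset.sum_pos' (fun y _ => sq_nonneg _)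
    ⟨x, Finset.mem_univ x, by have : w x ≠ 0 := sub_ne_zero.2 hx; positivity⟩
  have hscale : ∀ (u : X → ℝ) (b : ℝ), (∀ x, ∑ y, (if Adj x y then u y else 0) = μ * u x) →
      ∀ x, ∑ y, (if Adj x y then b * u y else 0) = μ * (b * u x) := by
    intro u b hu x
    rw [show μ * (b * u x) = b * (μ * u x) by ring, ← hu, Finset.mul_sum]
    exact Finset.sum_congr rfl fun y _ => by split_ifs <;> simp
  have hnorm : ∀ u : X → ℝ, 0 < ∑ x, u x ^ 2 →
      ∑ x, (√(Fintype.card X / ∑ x, u x ^ 2) * u x) ^ 2 = Fintype.card X := by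
    intro u hu
    simp only [mul_pow, ← Finset.mul_sum]
    rw [Real.sq_sqrt (by positivity), div_mul_cancel₀ _ hu.ne']
  refine false_of_orthogonal_eigenfunctions Adj hsymm hX hh hreg hμ _ _
    (hscale f _ hf) (hscale w _ hwf) ?_ (hnorm f hpos) (hnorm w hW)
  rw [Finset.sum_congr rfl fun x _ => mul_mul_mul_comm _ (f x) _ (w x), ← Finset.mul_sum, horth,
    mul_zero]

/-- Eigenvalues of non-bipartite Cayley sum graphs are bounded away from minus the degree. -/
theorem hOut_sq_le_card_add_eigenvalue (hS : ∀ x : X, ∀ s ∈ S, x * s * x⁻¹ ∈ S)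
    (hAdj : ∀ x y, Adj x y ↔ x * y ∈ S) (hX : 2 ≤ Fintype.card X) (hbip : ¬ Bipartite Adj)
    {μ : ℝ} (f : X → ℝ) (hf : ∀ x, ∑ y, (if Adj x y then f y else 0) = μ * f x)
    (hpos : 0 < ∑ x, f x ^ 2) : 1 / 1000 * hOut Adj ^ 2 ≤ S.card + μ := by
  have hsymm := cayleySum_symm hS hAdj
  have hreg : ∀ x, ∑ y, (if Adj x y then (1 : ℝ) else 0) = S.card := fun x => by
    rw [cayleySum_sum_adj hAdj (fun _ => 1)]
    simp
  by_contra! hlt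
  have hh0 := hOut_nonneg Adj
  have hh2 := hOut_le_two Adj hX
  have hh : 0 < hOut Adj := by
    refine hh0.lt_of_ne fun h0 => ?_
    rw [← h0] at hlt
    linarith [(eigenvalue_mem_Icc Adj hsymm hreg f hf hpos).1]
  choose χ hχ using exists_mul_left_eq_mul hS hAdj hX hh hreg hlt.le f hf hpos
  have hχ1 : ∀ g, f g = χ g * f 1 := fun g => by simpa using hχ g 1
  have hf1 : f 1 ≠ 0 := by
    intro h0
    have hf0 : ∀ g, f g = 0 := fun g => by rw [hχ1, h0, mul_zero]
    simp [hf0] at hpos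
  have hmul : ∀ g h, χ (g * h) = χ g * χ h := fun g h => by
    have := hχ g h
    rw [hχ1, hχ1 h, ← mul_assoc] at this
    exact mul_right_cancel₀ hf1 this
  have hsq : ∀ g, χ g = 1 ∨ χ g = -1 := by
    intro g
    have h1 : ∑ x, f (g * x) ^ 2 = ∑ x, f x ^ 2 :=
      Equiv.sum_comp (Equiv.mulLeft g) (fun x => f x ^ 2)
    simp only [hχ g, mul_pow, ← Finset.mul_sum] at h1
    refine sq_eq_sq_iff_eq_or_eq_neg.1 ?_
    rw [one_pow]
    exact mul_right_cancel₀ hpos.ne' (h1.trans (one_mul _).symm)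
  have hsum : ∑ s ∈ S, (1 + χ s) = S.card + μ := by
    have h1 := hf 1
    rw [cayleySum_sum_adj hAdj] at h1
    simp only [inv_one, one_mul] at h1
    rw [Finset.sum_congr rfl fun s _ => hχ1 s, ← Finset.sum_mul] at h1
    rw [Finset.sum_add_distrib, mul_right_cancel₀ hf1 h1]
    simp
  have hneg : ∀ s ∈ S, χ s = -1 := by
    intro s hs
    refine (hsq s).resolve_left fun h1 => ?_
    have h2 := Finset.single_le_sum (f := fun s => 1 + χ s)
      (fun s _ => by rcases hsq s with h | h <;> simp [h]) hs
    simp only [h1] at h2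
    nlinarith
  refine hbip ⟨fun x => decide (χ x = 1), fun x y hxy => ?_⟩
  have h1 := hneg _ ((hAdj x y).1 hxy)
  rw [hmul] at h1
  have hne : (-1 : ℝ) ≠ 1 := by norm_num
  rcases hsq x with hx | hx <;> rcases hsq y with hy | hy <;> rw [hx, hy] at h1
  · norm_num at h1
  · simp [hx, hy, hne]
  · simp [hx, hy, hne]
  · norm_num at h1

end CayleySum

/-- There are absolute constants `c, C > 0` such that for every non-bipartite finite Cayley sum
graph `C_Σ(X,S)` (with `S` normal, `d = |S| ≥ 1`, adjacency `x ∼ y ↔ xy ∈ S`), all eigenvalues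
of the normalized adjacency matrix `(1/d)A`, listed in increasing order with multiplicity as
`t₁ ≤ ⋯ ≤ t_N`, except possibly the largest one, lie in
`[-1 + c h_out²/d, 1 - C h_out²/d]`. -/
theorem cayleySum_eigenvalue_interval :
    ∃ c > (0 : ℝ), ∃ C > (0 : ℝ),
      ∀ (X : Type) [Group X] [Fintype X] (S : Finset X),
        (∀ x : X, ∀ s ∈ S, x * s * x⁻¹ ∈ S) →
        1 ≤ S.card →
        ¬ Bipartite (fun x y : X => x * y ∈ S) →
        ∀ (hM : Matrix.IsHermitian
          ((S.card : ℝ)⁻¹ •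
            Matrix.of (fun x y : X => if x * y ∈ S then (1 : ℝ) else 0)))
          (t : Fin (Fintype.card X) → ℝ),
        Monotone t →
        (∃ e : X ≃ Fin (Fintype.card X), ∀ x : X, t (e x) = hM.eigenvalues x) →
        ∀ i : Fin (Fintype.card X), (i : ℕ) < Fintype.card X - 1 →
          t i ∈ Set.Icc
            (-1 + c * hOut (fun x y : X => x * y ∈ S) ^ 2 / (S.card : ℝ))
            (1 - C * hOut (fun x y : X => x * y ∈ S) ^ 2 / (S.card : ℝ)) := by
  refine ⟨1 / 1000, by norm_num, 1 / 16, by norm_num, ?_⟩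
  intro X _ _ S hS hd hbip hM t ht ⟨e, he⟩ i hi
  generalize hAdjdef : (fun x y : X => x * y ∈ S) = Adj at hbip ⊢
  have hAdj : ∀ x y, Adj x y ↔ x * y ∈ S := fun x y => by rw [← hAdjdef]
  have hX : 2 ≤ Fintype.card X := by omega
  have hsymm := cayleySum_symm hS hAdj
  have hd0 : (0 : ℝ) < S.card := by exact_mod_cast hd
  have hreg : ∀ x, ∑ y, (if Adj x y then (1 : ℝ) else 0) = S.card := fun x => by
    rw [cayleySum_sum_adj hAdj (fun _ => 1)]
    simp
  have heig : ∀ j x, ∑ y, (if Adj x y then hM.eigenvectorBasis j y else 0) =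
      S.card * hM.eigenvalues j * hM.eigenvectorBasis j x := by
    intro j x
    have h1 := congrFun (hM.mulVec_eigenvectorBasis j) x
    rw [Matrix.smul_mulVec] at h1
    simp only [Pi.smul_apply, smul_eq_mul, Matrix.mulVec, dotProduct,
      Matrix.of_apply, ite_mul, one_mul, zero_mul] at h1
    rw [mul_assoc, ← h1, mul_inv_cancel_left₀ hd0.ne']
    exact Finset.sum_congr rfl fun y _ => if_congr (hAdj x y) rfl rfl
  have hinner : ∀ j k, ∑ x, hM.eigenvectorBasis j x * hM.eigenvectorBasis k x =
      if j = k then 1 else 0 := by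
    intro j k
    have h1 := (orthonormal_iff_ite.1 hM.eigenvectorBasis.orthonormal) k j
    simp only [PiLp.inner_apply, RCLike.inner_apply, conj_trivial] at h1
    rw [h1]
    exact if_congr eq_comm rfl rfl
  have hpos : ∀ j, 0 < ∑ x, hM.eigenvectorBasis j x ^ 2 := fun j => by
    simp only [sq, hinner j j, if_true, zero_lt_one]
  have hti : ∀ k, t k = hM.eigenvalues (e.symm k) := fun k => by rw [← he, e.apply_symm_apply]
  constructor
  · have h1 := hOut_sq_le_card_add_eigenvalue hS hAdj hX hbip _ (heig (e.symm i)) (hpos _)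
    rw [← hti] at h1
    have : 1 / 1000 * hOut Adj ^ 2 / S.card ≤ 1 + t i := by
      rw [div_le_iff₀ hd0]
      linarith
    linarith
  · by_cases hne : (S.card : ℝ) * t i = S.card
    · have hti1 : t i = 1 := mul_left_cancel₀ hd0.ne' (hne.trans (mul_one _).symm)
      rcases (hOut_nonneg Adj).eq_or_lt with hh | hh
      · rw [← hh, hti1]
        norm_num
      · exfalso
        set l : Fin (Fintype.card X) := ⟨Fintype.card X - 1, by omega⟩ with hl
        have hil : i ≠ l := fun h => by
          rw [h] at hi
          simp [hl] at hi
        have hle : t i ≤ t l := ht (Fin.le_def.2 hi.le)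
        have hl1 := (eigenvalue_mem_Icc Adj hsymm hreg _ (heig (e.symm l)) (hpos _)).2
        rw [← hti] at hl1
        have htl : (S.card : ℝ) * t l = S.card := by nlinarith
        have hci := heig (e.symm i)
        have hcl := heig (e.symm l)
        rw [← hti, hne] at hci
        rw [← hti, htl] at hcl
        obtain ⟨a, ha⟩ := eq_of_eigenvalue_eq Adj hsymm hX hh hreg _ hci
        obtain ⟨b, hb⟩ := eq_of_eigenvalue_eq Adj hsymm hX hh hreg _ hcl
        have hab := hinner (e.symm i) (e.symm l)
        rw [if_neg (e.symm.injective.ne hil)] at hab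
        have hapos := hpos (e.symm i)
        have hbpos := hpos (e.symm l)
        simp only [ha, hb, Finset.sum_const, Finset.card_univ, nsmul_eq_mul] at hab hapos hbpos
        have hX0 : (Fintype.card X : ℝ) ≠ 0 := by exact_mod_cast (by omega : Fintype.card X ≠ 0)
        rcases mul_eq_zero.1 ((mul_eq_zero.1 hab).resolve_left hX0) with h0 | h0
        · simp [h0] at hapos
        · simp [h0] at hbpos
    · have h1 := hOut_sq_mul_le_of_eigenvalue_ne Adj hsymm hX hreg _ (heig (e.symm i))
        (by rwa [← hti]) (hpos _)
      rw [← hti] at h1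
      have : 1 / 16 * hOut Adj ^ 2 / S.card ≤ 1 - t i := by
        rw [div_le_iff₀ hd0]
        linarith
      linarith
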